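/- arXiv:1908.00813 — 3 statements merged into one kernel-verified Lean document; each statement's English description precedes it below -/
import Mathlib

section
/- Let U ⊆ ℝ² be open, let F : U → ℝ² be twice continuously differentiable with det DF(ξ) > 0 for all ξ ∈ U, let V ⊆ ℝ² be open with F(U) ⊆ V, and let u : V → ℝ be twice continuously differentiable. Denote J(ξ) = DF(ξ) (the 2×2 Jacobian matrix) and define the matrix field N(ξ) = det J(ξ) · J(ξ)⁻¹ · (J(ξ)ᵀ)⁻¹ and the vector field w(ξ) = N(ξ)·∇(u∘F)(ξ), where ∇ denotes the gradient. Then for every ξ ∈ U, div w(ξ) = det J(ξ) · (Δu)(F(ξ)), where div denotes the divergence (the trace of the Fréchet derivative) and Δ the Laplacian. -/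
open Matrix

/-- Partial derivative with respect to the first coordinate. -/
noncomputable def pd1 (f : ℝ × ℝ → ℝ) (x : ℝ × ℝ) : ℝ := fderiv ℝ f x (1, 0)

/-- Partial derivative with respect to the second coordinate. -/
noncomputable def pd2 (f : ℝ × ℝ → ℝ) (x : ℝ × ℝ) : ℝ := fderiv ℝ f x (0, 1)

/-- The Jacobian matrix of a map `F : ℝ² → ℝ²`. -/
noncomputable def Jac (F : ℝ × ℝ → ℝ × ℝ) (x : ℝ × ℝ) : Matrix (Fin 2) (Fin 2) ℝ :=
  !![pd1 (fun y => (F y).1) x, pd2 (fun y => (F y).1) x;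
     pd1 (fun y => (F y).2) x, pd2 (fun y => (F y).2) x]

theorem fderiv_apply_eq_pd (g : ℝ × ℝ → ℝ) (y v : ℝ × ℝ) :
    fderiv ℝ g y v = pd1 g y * v.1 + pd2 g y * v.2 := by
  have hv : v = v.1 • ((1, 0) : ℝ × ℝ) + v.2 • ((0, 1) : ℝ × ℝ) := by ext <;> simp
  conv_lhs => rw [hv, map_add, map_smul, map_smul]
  simp only [pd1, pd2, smul_eq_mul]
  ring

theorem fderiv_comp_apply_eq_pd {g : ℝ × ℝ → ℝ} {F : ℝ × ℝ → ℝ × ℝ} {x : ℝ × ℝ}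
    (hg : DifferentiableAt ℝ g (F x)) (hF : DifferentiableAt ℝ F x) (v : ℝ × ℝ) :
    fderiv ℝ (fun y => g (F y)) x v =
      pd1 g (F x) * fderiv ℝ (fun y => (F y).1) x v +
        pd2 g (F x) * fderiv ℝ (fun y => (F y).2) x v := by
  have hcomp : fderiv ℝ (fun y => g (F y)) x = _ := (hg.hasFDerivAt.comp x hF.hasFDerivAt).fderiv
  rw [hcomp, hF.hasFDerivAt.fst.fderiv,
    hF.hasFDerivAt.snd.fderiv]
  exact fderiv_apply_eq_pd g (F x) (fderiv ℝ F x v)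

theorem differentiableAt_fderiv_apply {f : ℝ × ℝ → ℝ} {x : ℝ × ℝ} (hf : ContDiffAt ℝ 2 f x)
    (v : ℝ × ℝ) : DifferentiableAt ℝ (fun y => fderiv ℝ f y v) x :=
  ((hf.fderiv_right (m := 1) (by norm_num)).differentiableAt (by norm_num)).clm_apply
    (differentiableAt_const v)

theorem pd1_pd2_eq_pd2_pd1 {f : ℝ × ℝ → ℝ} {x : ℝ × ℝ} (hf : ContDiffAt ℝ 2 f x) :
    pd1 (pd2 f) x = pd2 (pd1 f) x := by
  have hd : DifferentiableAt ℝ (fderiv ℝ f) x :=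
    (hf.fderiv_right (m := 1) (by norm_num)).differentiableAt (by norm_num)
  have key (v w : ℝ × ℝ) :
      fderiv ℝ (fun y => fderiv ℝ f y v) x w = fderiv ℝ (fderiv ℝ f) x w v := by
    rw [fderiv_clm_apply hd (differentiableAt_const v)]
    simp
  have hs : IsSymmSndFDerivAt ℝ f x := hf.isSymmSndFDerivAt (by simp)
  exact (key _ _).trans ((hs.eq _ _).trans (key _ _).symm)

/-- `det J · J⁻¹ · J⁻ᵀ` applied to `Jᵀ (p, q)` is the adjugate of `J` applied to `(p, q)`. -/
theorem det_smul_inv_mul_inv_transpose_mulVec (a b c d p q : ℝ)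
    (h : (!![a, b; c, d] : Matrix (Fin 2) (Fin 2) ℝ).det ≠ 0) :
    ((!![a, b; c, d] : Matrix (Fin 2) (Fin 2) ℝ).det •
      ((!![a, b; c, d] : Matrix (Fin 2) (Fin 2) ℝ)⁻¹ *
        ((!![a, b; c, d] : Matrix (Fin 2) (Fin 2) ℝ)ᵀ)⁻¹)) *ᵥ ![p * a + q * c, p * b + q * d] =
      ![d * p - b * q, a * q - c * p] := by
  have hv : ![p * a + q * c, p * b + q * d] =
      (!![a, b; c, d] : Matrix (Fin 2) (Fin 2) ℝ)ᵀ *ᵥ ![p, q] := by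
    ext i
    fin_cases i <;> simp [Matrix.mulVec, dotProduct, Fin.sum_univ_two] <;> ring
  have hu : IsUnit (!![a, b; c, d] : Matrix (Fin 2) (Fin 2) ℝ)ᵀ.det := by
    rw [Matrix.det_transpose]
    exact isUnit_iff_ne_zero.mpr h
  rw [hv, Matrix.mulVec_mulVec, Matrix.smul_mul, Matrix.mul_assoc, Matrix.nonsing_inv_mul _ hu,
    Matrix.mul_one, Matrix.inv_def, smul_smul, Ring.mul_inverse_cancel _ (isUnit_iff_ne_zero.mpr h),
    one_smul, Matrix.adjugate_fin_two_of]
  ext i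
  fin_cases i <;> simp [Matrix.mulVec, dotProduct, Fin.sum_univ_two] <;> ring

theorem fderiv_mul_sub_mul_apply {f g h k : ℝ × ℝ → ℝ} {x : ℝ × ℝ} (hf : DifferentiableAt ℝ f x)
    (hg : DifferentiableAt ℝ g x) (hh : DifferentiableAt ℝ h x) (hk : DifferentiableAt ℝ k x)
    (v : ℝ × ℝ) :
    fderiv ℝ (fun y => f y * g y - h y * k y) x v =
      f x * fderiv ℝ g x v + g x * fderiv ℝ f x v -
        (h x * fderiv ℝ k x v + k x * fderiv ℝ h x v) := by
  rw [fderiv_fun_sub (hf.fun_mul hg) (hh.fun_mul hk), fderiv_fun_mul hf hg, fderiv_fun_mul hh hk]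
  simp

/-- Piola/pullback identity for the Laplacian: for `F : U → ℝ²` twice
continuously differentiable with `det DF > 0` on the open set `U`, `u : V → ℝ` twice
continuously differentiable on the open set `V ⊇ F(U)`, `J = DF`,
`N = det J · J⁻¹ · (Jᵀ)⁻¹` and `w = N·∇(u∘F)`, one has
`div w(ξ) = det J(ξ) · (Δu)(F(ξ))` for every `ξ ∈ U`. -/
theorem piola_identity_laplacian (U V : Set (ℝ × ℝ)) (hU : IsOpen U) (hV : IsOpen V)
    (F : ℝ × ℝ → ℝ × ℝ) (hF : ContDiffOn ℝ 2 F U)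
    (hdet : ∀ ξ ∈ U, 0 < (Jac F ξ).det)
    (hFUV : F '' U ⊆ V)
    (u : ℝ × ℝ → ℝ) (hu : ContDiffOn ℝ 2 u V)
    (N : ℝ × ℝ → Matrix (Fin 2) (Fin 2) ℝ)
    (hN : ∀ ξ, N ξ = (Jac F ξ).det • ((Jac F ξ)⁻¹ * ((Jac F ξ)ᵀ)⁻¹))
    (w : ℝ × ℝ → ℝ × ℝ)
    (hw : ∀ ξ, w ξ = ((N ξ *ᵥ ![pd1 (u ∘ F) ξ, pd2 (u ∘ F) ξ]) 0,
                      (N ξ *ᵥ ![pd1 (u ∘ F) ξ, pd2 (u ∘ F) ξ]) 1)) :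
    ∀ ξ ∈ U,
      pd1 (fun x => (w x).1) ξ + pd2 (fun x => (w x).2) ξ =
        (Jac F ξ).det * (pd1 (fun x => pd1 u x) (F ξ) + pd2 (fun x => pd2 u x) (F ξ)) := by
  intro ξ hξ
  have hFat : ∀ x ∈ U, ContDiffAt ℝ 2 F x := fun x hx => hF.contDiffAt (hU.mem_nhds hx)
  have huat : ∀ x ∈ U, ContDiffAt ℝ 2 u (F x) := fun x hx =>
    hu.contDiffAt (hV.mem_nhds (hFUV ⟨x, hx, rfl⟩))
  have hw' : ∀ x ∈ U, w x =
      (pd2 (fun y => (F y).2) x * pd1 u (F x) - pd2 (fun y => (F y).1) x * pd2 u (F x),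
        pd1 (fun y => (F y).1) x * pd2 u (F x) - pd1 (fun y => (F y).2) x * pd1 u (F x)) := by
    intro x hx
    have hgrad := fderiv_comp_apply_eq_pd ((huat x hx).differentiableAt (by norm_num))
      ((hFat x hx).differentiableAt (by norm_num))
    have h1 : pd1 (u ∘ F) x = _ := hgrad (1, 0)
    have h2 : pd2 (u ∘ F) x = _ := hgrad (0, 1)
    have hmul := det_smul_inv_mul_inv_transpose_mulVec _ _ _ _ (pd1 u (F x)) (pd2 u (F x))
      (hdet x hx).ne'
    rw [hw, hN, h1, h2]
    exact Prod.ext (congrFun hmul 0) (congrFun hmul 1)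
  have hUξ := hU.mem_nhds hξ
  have hw1 : (fun x => (w x).1) =ᶠ[nhds ξ] fun x =>
      pd2 (fun y => (F y).2) x * pd1 u (F x) - pd2 (fun y => (F y).1) x * pd2 u (F x) := by
    filter_upwards [hUξ] with x hx
    rw [hw' x hx]
  have hw2 : (fun x => (w x).2) =ᶠ[nhds ξ] fun x =>
      pd1 (fun y => (F y).1) x * pd2 u (F x) - pd1 (fun y => (F y).2) x * pd1 u (F x) := by
    filter_upwards [hUξ] with x hx
    rw [hw' x hx]
  have hF1 : ContDiffAt ℝ 2 (fun y => (F y).1) ξ := (hFat ξ hξ).fst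
  have hF2 : ContDiffAt ℝ 2 (fun y => (F y).2) ξ := (hFat ξ hξ).snd
  have hFd : DifferentiableAt ℝ F ξ := (hFat ξ hξ).differentiableAt (by norm_num)
  have hu1 : DifferentiableAt ℝ (pd1 u) (F ξ) := differentiableAt_fderiv_apply (huat ξ hξ) _
  have hu2 : DifferentiableAt ℝ (pd2 u) (F ξ) := differentiableAt_fderiv_apply (huat ξ hξ) _
  have hp : DifferentiableAt ℝ (fun x => pd1 u (F x)) ξ := hu1.comp ξ hFd
  have hq : DifferentiableAt ℝ (fun x => pd2 u (F x)) ξ := hu2.comp ξ hFd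
  have e1 : pd1 (fun x => (w x).1) ξ = _ :=
    (congrArg (fun L : ℝ × ℝ →L[ℝ] ℝ => L (1, 0)) hw1.fderiv_eq).trans
      (fderiv_mul_sub_mul_apply (differentiableAt_fderiv_apply hF2 (0, 1)) hp
        (differentiableAt_fderiv_apply hF1 (0, 1)) hq (1, 0))
  have e2 : pd2 (fun x => (w x).2) ξ = _ :=
    (congrArg (fun L : ℝ × ℝ →L[ℝ] ℝ => L (0, 1)) hw2.fderiv_eq).trans
      (fderiv_mul_sub_mul_apply (differentiableAt_fderiv_apply hF1 (1, 0)) hq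
        (differentiableAt_fderiv_apply hF2 (1, 0)) hp (0, 1))
  rw [fderiv_comp_apply_eq_pd hu1 hFd, fderiv_comp_apply_eq_pd hu2 hFd] at e1 e2
  have s1 := pd1_pd2_eq_pd2_pd1 hF1
  have s2 := pd1_pd2_eq_pd2_pd1 hF2
  rw [e1, e2, Jac, Matrix.det_fin_two_of]
  unfold pd1 pd2 at *
  linear_combination fderiv ℝ u (F ξ) (1, 0) * s2 - fderiv ℝ u (F ξ) (0, 1) * s1
end

section
/- Let φ : Ω → ℝ be defined by φ(x) = g^τ((F^τ)⁻¹(x)) for x ∈ Ω^τ ∪ Γ (τ = 0, 1). Then φ is well defined and twice continuously differentiable on Ω if and only if for all ξ ∈ [0,1] the following three conditions hold, where g₀(ξ) := g⁰(0,ξ) and g₁(ξ) := (∂₁g⁰(0,ξ) − β⁰(ξ)·g₀′(ξ))/α⁰(ξ): (i) g⁰(0,ξ) = g¹(0,ξ); (ii) (∂₁g⁰(0,ξ) − β⁰(ξ)·g₀′(ξ))/α⁰(ξ) = (∂₁g¹(0,ξ) − β¹(ξ)·g₀′(ξ))/α¹(ξ); (iii) (∂₁∂₁g⁰(0,ξ)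 − (β⁰(ξ))²·g₀″(ξ) − 2α⁰(ξ)β⁰(ξ)·g₁′(ξ))/(α⁰(ξ))² = (∂₁∂₁g¹(0,ξ) − (β¹(ξ))²·g₀″(ξ) − 2α¹(ξ)β¹(ξ)·g₁′(ξ))/(α¹(ξ))². -/
open Set

section IsogeometricGluing
open Filter Topology Asymptotics

section Analysis

theorem continuousOn_indicator_nonpos {E F : Type*} [TopologicalSpace E]
    [TopologicalSpace F] [Zero F] {X : E → ℝ} (hX : Continuous X) {f : E → F}
    {W : Set E} (hf : ContinuousOn f W) (h0 : ∀ x ∈ W, X x = 0 → f x = 0) :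
    ContinuousOn ({y | X y ≤ 0}.indicator f) W := by
  classical
  rw [← piecewise_eq_indicator]
  refine ContinuousOn.piecewise ?_ (hf.mono inter_subset_left) continuousOn_const
  rintro x ⟨hxW, hx⟩
  exact h0 x hxW (frontier_le_subset_eq hX continuous_const hx)

variable {E F : Type*} [NormedAddCommGroup E] [NormedSpace ℝ E]
  [NormedAddCommGroup F] [NormedSpace ℝ F]

theorem hasFDerivAt_indicator_nonpos {X : E → ℝ} (hX : Continuous X) {f : E → F}
    {f' : E → E →L[ℝ] F} {x : E} (hf : HasFDerivAt f (f' x) x)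
    (h0 : X x = 0 → f x = 0) (h1 : X x = 0 → f' x = 0) :
    HasFDerivAt ({y | X y ≤ 0}.indicator f) ({y | X y ≤ 0}.indicator f' x) x := by
  rcases lt_trichotomy (X x) 0 with h | h | h
  · rw [indicator_of_mem (show x ∈ {y | X y ≤ 0} from h.le)]
    refine hf.congr_of_eventuallyEq ?_
    filter_upwards [hX.continuousAt.eventually_lt continuousAt_const h] with y hy
    exact indicator_of_mem (show y ∈ {y | X y ≤ 0} from hy.le) f
  · rw [indicator_of_mem (show x ∈ {y | X y ≤ 0} from h.le)]
    rw [h1 h] at hf ⊢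
    rw [hasFDerivAt_iff_isLittleO] at hf ⊢
    refine IsBigO.trans_isLittleO (IsBigO.of_bound 1 (Eventually.of_forall fun y => ?_)) hf
    rw [indicator_of_mem (show x ∈ {y | X y ≤ 0} from h.le), h0 h]
    simpa using norm_indicator_le_norm_self f y
  · rw [indicator_of_notMem (show x ∉ {y | X y ≤ 0} from not_le.2 h)]
    refine (hasFDerivAt_const (0 : F) x).congr_of_eventuallyEq ?_
    filter_upwards [continuousAt_const.eventually_lt hX.continuousAt h] with y hy
    exact indicator_of_notMem (show y ∉ {y | X y ≤ 0} from not_le.2 hy) f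

theorem contDiffOn_succ_indicator_nonpos {X : E → ℝ} (hX : Continuous X) {f : E → F}
    {W : Set E} (hW : IsOpen W) (hf : DifferentiableOn ℝ f W)
    (h0 : ∀ x ∈ W, X x = 0 → f x = 0) (h1 : ∀ x ∈ W, X x = 0 → fderiv ℝ f x = 0) {n : ℕ}
    (hn : ContDiffOn ℝ n ({y | X y ≤ 0}.indicator (fderiv ℝ f)) W) :
    ContDiffOn ℝ (n + 1) ({y | X y ≤ 0}.indicator f) W := by
  have key : ∀ x ∈ W, HasFDerivAt ({y | X y ≤ 0}.indicator f)
      ({y | X y ≤ 0}.indicator (fderiv ℝ f) x) x := fun x hx =>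
    hasFDerivAt_indicator_nonpos hX (hf.differentiableAt (hW.mem_nhds hx)).hasFDerivAt
      (h0 x hx) (h1 x hx)
  rw [contDiffOn_succ_iff_fderiv_of_isOpen hW]
  exact ⟨fun x hx => (key x hx).differentiableAt.differentiableWithinAt, by simp,
    hn.congr fun x hx => (key x hx).fderiv⟩

/-- Truncating a `C²` function along a level set where its 2-jet vanishes keeps it `C²`. -/
theorem contDiffOn_two_indicator_nonpos {X : E → ℝ} (hX : Continuous X) {f : E → F}
    {W : Set E} (hW : IsOpen W) (hf : ContDiffOn ℝ 2 f W)
    (h0 : ∀ x ∈ W, X x = 0 → f x = 0) (h1 : ∀ x ∈ W, X x = 0 → fderiv ℝ f x = 0)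
    (h2 : ∀ x ∈ W, X x = 0 → fderiv ℝ (fderiv ℝ f) x = 0) :
    ContDiffOn ℝ 2 ({y | X y ≤ 0}.indicator f) W := by
  have hf1 : ContDiffOn ℝ 1 (fderiv ℝ f) W := hf.fderiv_of_isOpen hW (by norm_num)
  have hf2 : ContDiffOn ℝ 0 (fderiv ℝ (fderiv ℝ f)) W := hf1.fderiv_of_isOpen hW (by norm_num)
  have s0 : ContDiffOn ℝ (0 : ℕ) ({y | X y ≤ 0}.indicator (fderiv ℝ (fderiv ℝ f))) W :=
    contDiffOn_zero.2 (continuousOn_indicator_nonpos hX hf2.continuousOn h2)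
  have s1 := contDiffOn_succ_indicator_nonpos hX hW (hf1.differentiableOn (by norm_num)) h1 h2 s0
  have s2 := contDiffOn_succ_indicator_nonpos (n := 1) hX hW (hf.differentiableOn (by norm_num))
    h0 h1 (by simpa using s1)
  simpa [one_add_one_eq_two] using s2

theorem deriv_comp_add_smul {f : E → F} {p v : E} {r : ℝ}
    (hf : DifferentiableAt ℝ f (p + r • v)) :
    deriv (fun t : ℝ => f (p + t • v)) r = fderiv ℝ f (p + r • v) v := by
  have h : HasDerivAt (fun t : ℝ => p + t • v) v r := by
    simpa using ((hasDerivAt_id r).smul_const v).const_add p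
  exact (hf.hasFDerivAt.comp_hasDerivAt r h).deriv

theorem iteratedDeriv_two_comp_add_smul {f : E → F} {p v : E} {r : ℝ}
    (hf : ContDiffAt ℝ 2 f (p + r • v)) :
    iteratedDeriv 2 (fun t : ℝ => f (p + t • v)) r =
      fderiv ℝ (fderiv ℝ f) (p + r • v) v v := by
  have hc : ContinuousAt (fun t : ℝ => p + t • v) r := by fun_prop
  have hev : ∀ᶠ t : ℝ in 𝓝 r, deriv (fun t : ℝ => f (p + t • v)) t =
      fderiv ℝ f (p + t • v) v := by
    filter_upwards [hc.eventually (hf.eventually (by simp))] with t ht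
    exact deriv_comp_add_smul (ht.differentiableAt (by norm_num))
  rw [iteratedDeriv_succ, iteratedDeriv_one, EventuallyEq.deriv_eq hev]
  have hd : DifferentiableAt ℝ (fderiv ℝ f) (p + r • v) :=
    (hf.fderiv_right (m := 1) (by norm_num)).differentiableAt (by norm_num)
  rw [deriv_comp_add_smul (f := fun x => fderiv ℝ f x v)
    (hd.clm_apply (differentiableAt_const _)), fderiv_clm_apply hd (differentiableAt_const _)]
  simp

theorem iteratedDeriv_congr_right {f g : ℝ → F} {r : ℝ} {n : ℕ} (hf : ContDiffAt ℝ n f r)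
    (hg : ContDiffAt ℝ n g r) (h : f =ᶠ[𝓝[≥] r] g) :
    iteratedDeriv n f r = iteratedDeriv n g r := by
  have hr : r ∈ Ici r := self_mem_Ici
  rw [← iteratedDerivWithin_eq_iteratedDeriv (uniqueDiffOn_Ici r) hf hr,
    ← iteratedDerivWithin_eq_iteratedDeriv (uniqueDiffOn_Ici r) hg hr]
  exact h.iteratedDerivWithin_eq (h.eq_of_nhdsWithin hr)

/-- `f` has a `C²` local inverse at `q`. -/
def HasLocalInverse (f : E → E) (q : E) : Prop :=
  ∃ h : E → E, ContDiffAt ℝ 2 h (f q) ∧ h (f q) = q ∧ (∀ᶠ x in 𝓝 (f q), f (h x) = x) ∧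
    ∀ᶠ y in 𝓝 q, h (f y) = y

theorem HasFDerivAt.hasLocalInverse [FiniteDimensional ℝ E] {f : E → E} {f' : E →L[ℝ] E} {q : E}
    (hf' : HasFDerivAt f f' q) (hf : ContDiffAt ℝ 2 f q) (hinj : Function.Injective f') :
    HasLocalInverse f q := by
  have : CompleteSpace E := FiniteDimensional.complete ℝ E
  let e : E ≃L[ℝ] E := (LinearEquiv.ofInjectiveEndo (f' : E →ₗ[ℝ] E) hinj).toContinuousLinearEquiv
  have he : HasFDerivAt f (e : E →L[ℝ] E) q := by
    convert hf'
    ext v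
    rfl
  have hs := hf.hasStrictFDerivAt' he (by norm_num)
  exact ⟨hf.localInverse he (by norm_num), hf.to_localInverse he (by norm_num),
    hs.localInverse_apply_image, hs.eventually_right_inverse, hs.eventually_left_inverse⟩

theorem HasLocalInverse.contDiffAt_of_comp_eq {f : E → E} {q : E} (h : HasLocalInverse f q)
    {φ g : E → F} (hg : ContDiffAt ℝ 2 g q) (heq : ∀ᶠ y in 𝓝 q, φ (f y) = g y) :
    ContDiffAt ℝ 2 φ (f q) := by
  obtain ⟨k, hk, hkq, hr, -⟩ := h
  rw [← hkq] at hg heq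
  refine (hg.comp (f q) hk).congr_of_eventuallyEq ?_
  filter_upwards [hk.continuousAt.eventually heq, hr] with x hx hx'
  rw [hx'] at hx
  exact hx

end Analysis

/-- The transversal derivative `(∂₁g − β γ') / α` along the interface, `γ` being the trace. -/
noncomputable def normalDeriv (g : ℝ × ℝ → ℝ) (α β γ : ℝ → ℝ) (s : ℝ) : ℝ :=
  (deriv (fun t => g (t, s)) 0 - β s * deriv γ s) / α s

/-- The second transversal derivative along the interface, `γ` being the trace and `δ` the
transversal derivative. -/
noncomputable def normalDeriv₂ (g : ℝ × ℝ → ℝ) (α β γ δ : ℝ → ℝ) (s : ℝ) : ℝ :=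
  (iteratedDeriv 2 (fun t => g (t, s)) 0 - (β s) ^ 2 * iteratedDeriv 2 γ s -
    2 * α s * β s * deriv δ s) / (α s) ^ 2

/-- The `G²`-gluing conditions at the interface parameter `ξ`. -/
def GluingAt (g₀ g₁ : ℝ × ℝ → ℝ) (α₀ β₀ α₁ β₁ : ℝ → ℝ) (ξ : ℝ) : Prop :=
  g₀ (0, ξ) = g₁ (0, ξ) ∧
  normalDeriv g₀ α₀ β₀ (fun s => g₀ (0, s)) ξ = normalDeriv g₁ α₁ β₁ (fun s => g₀ (0, s)) ξ ∧
  normalDeriv₂ g₀ α₀ β₀ (fun s => g₀ (0, s)) (normalDeriv g₀ α₀ β₀ fun s => g₀ (0, s)) ξ =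
    normalDeriv₂ g₁ α₁ β₁ (fun s => g₀ (0, s)) (normalDeriv g₀ α₀ β₀ fun s => g₀ (0, s)) ξ

/-- The map `f` has the form `(t, s) ↦ a + s c + t (α(s) n + β(s) c)`. -/
def IsAdaptedPatch (f : ℝ × ℝ → ℝ × ℝ) (a c n : ℝ × ℝ) (α β : ℝ → ℝ) : Prop :=
  ∀ t s : ℝ, f (t, s) = (a + s • c) + t • (α s • n + β s • c)

namespace IsAdaptedPatch

variable {f : ℝ × ℝ → ℝ × ℝ} {a c n : ℝ × ℝ} {α β γ δ : ℝ → ℝ} {g φ : ℝ × ℝ → ℝ} {ξ : ℝ}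

theorem apply_zero (hf : IsAdaptedPatch f a c n α β) (s : ℝ) : f (0, s) = a + s • c := by
  simp [hf 0 s]

theorem normalDeriv_eq (hf : IsAdaptedPatch f a c n α β) (hφ : ContDiffAt ℝ 2 φ (a + ξ • c))
    (hg : ContDiffAt ℝ 2 g (0, ξ)) (hα : α ξ ≠ 0) (hγ : γ =ᶠ[𝓝 ξ] fun s => φ (a + s • c))
    (heq : ∀ᶠ t in 𝓝[≥] (0 : ℝ), φ (f (t, ξ)) = g (t, ξ)) :
    normalDeriv g α β γ ξ = fderiv ℝ φ (a + ξ • c) n := by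
  have hφd : DifferentiableAt ℝ φ (a + ξ • c) := hφ.differentiableAt (by norm_num)
  have h1 : deriv (fun t => g (t, ξ)) 0 =
      fderiv ℝ φ (a + ξ • c) (α ξ • n + β ξ • c) := by
    have h := deriv_comp_add_smul (f := φ) (p := a + ξ • c) (v := α ξ • n + β ξ • c) (r := 0)
      (by simpa using hφd)
    rw [zero_smul, add_zero] at h
    rw [← h, ← iteratedDeriv_one, ← iteratedDeriv_one]
    refine iteratedDeriv_congr_right ?_ ?_ ?_
    · exact (hg.of_le (by norm_num)).comp (0 : ℝ) (by fun_prop)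
    · refine ContDiffAt.comp (0 : ℝ) (g := φ) ?_ (by fun_prop)
      simpa using hφ.of_le (by norm_num)
    · filter_upwards [heq] with t ht
      rw [← ht, hf]
  have h2 : deriv γ ξ = fderiv ℝ φ (a + ξ • c) c := by
    rw [hγ.deriv_eq, deriv_comp_add_smul hφd]
  rw [normalDeriv, h1, h2, div_eq_iff hα]
  simp
  ring

theorem normalDeriv₂_eq (hf : IsAdaptedPatch f a c n α β) (hφ : ContDiffAt ℝ 2 φ (a + ξ • c))
    (hg : ContDiffAt ℝ 2 g (0, ξ)) (hα : α ξ ≠ 0) (hγ : γ =ᶠ[𝓝 ξ] fun s => φ (a + s • c))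
    (hδ : δ =ᶠ[𝓝 ξ] fun s => fderiv ℝ φ (a + s • c) n)
    (heq : ∀ᶠ t in 𝓝[≥] (0 : ℝ), φ (f (t, ξ)) = g (t, ξ)) :
    normalDeriv₂ g α β γ δ ξ = fderiv ℝ (fderiv ℝ φ) (a + ξ • c) n n := by
  have hd : DifferentiableAt ℝ (fderiv ℝ φ) (a + ξ • c) :=
    (hφ.fderiv_right (m := 1) (by norm_num)).differentiableAt (by norm_num)
  have h1 : iteratedDeriv 2 (fun t => g (t, ξ)) 0 =
      fderiv ℝ (fderiv ℝ φ) (a + ξ • c) (α ξ • n + β ξ • c) (α ξ • n + β ξ • c) := by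
    have h := iteratedDeriv_two_comp_add_smul (f := φ) (p := a + ξ • c)
      (v := α ξ • n + β ξ • c) (r := 0) (by simpa using hφ)
    rw [zero_smul, add_zero] at h
    rw [← h]
    refine iteratedDeriv_congr_right ?_ ?_ ?_
    · exact hg.comp (0 : ℝ) (by fun_prop)
    · refine ContDiffAt.comp (0 : ℝ) (g := φ) ?_ (by fun_prop)
      simpa using hφ
    · filter_upwards [heq] with t ht
      rw [← ht, hf]
  have h2 : iteratedDeriv 2 γ ξ = fderiv ℝ (fderiv ℝ φ) (a + ξ • c) c c := by
    rw [hγ.iteratedDeriv_eq, iteratedDeriv_two_comp_add_smul hφ]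
  have h3 : deriv δ ξ = fderiv ℝ (fderiv ℝ φ) (a + ξ • c) c n := by
    rw [hδ.deriv_eq, deriv_comp_add_smul (f := fun x => fderiv ℝ φ x n)
      (hd.clm_apply (differentiableAt_const _)), fderiv_clm_apply hd (differentiableAt_const _)]
    simp
  have hsymm : fderiv ℝ (fderiv ℝ φ) (a + ξ • c) n c = fderiv ℝ (fderiv ℝ φ) (a + ξ • c) c n :=
    (hφ.isSymmSndFDerivAt (by simp)).eq n c
  rw [normalDeriv₂, h1, h2, h3, div_eq_iff (pow_ne_zero 2 hα)]
  simp [hsymm]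
  ring

end IsAdaptedPatch

section TwoPatches

variable {f₀ f₁ : ℝ × ℝ → ℝ × ℝ} {a c n : ℝ × ℝ} {α₀ β₀ α₁ β₁ : ℝ → ℝ} {g₀ g₁ : ℝ × ℝ → ℝ} {ξ : ℝ}

theorem gluingAt_of_contDiffAt {φ : ℝ × ℝ → ℝ} (hf₀ : IsAdaptedPatch f₀ a c n α₀ β₀)
    (hf₁ : IsAdaptedPatch f₁ a c n α₁ β₁) (hφ : ContDiffAt ℝ 2 φ (a + ξ • c))
    (hg₀ : ContDiffAt ℝ 2 g₀ (0, ξ)) (hg₁ : ContDiffAt ℝ 2 g₁ (0, ξ))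
    (hα₀ : ∀ᶠ s in 𝓝 ξ, α₀ s ≠ 0) (hα₁ : α₁ ξ ≠ 0)
    (h₀ : ∀ᶠ s in 𝓝 ξ, ∀ᶠ t in 𝓝[≥] (0 : ℝ), φ (f₀ (t, s)) = g₀ (t, s))
    (h₁ : ∀ᶠ t in 𝓝[≥] (0 : ℝ), φ (f₁ (t, ξ)) = g₁ (t, ξ)) :
    GluingAt g₀ g₁ α₀ β₀ α₁ β₁ ξ := by
  have htr : (fun s => g₀ (0, s)) =ᶠ[𝓝 ξ] fun s => φ (a + s • c) := by
    filter_upwards [h₀] with s hs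
    rw [← hf₀.apply_zero, hs.self_of_nhdsWithin self_mem_Ici]
  have hc : ContinuousAt (fun s : ℝ => a + s • c) ξ := by fun_prop
  have hc' : ContinuousAt (fun s : ℝ => ((0 : ℝ), s)) ξ := by fun_prop
  have hnd : normalDeriv g₀ α₀ β₀ (fun s => g₀ (0, s)) =ᶠ[𝓝 ξ]
      fun s => fderiv ℝ φ (a + s • c) n := by
    filter_upwards [h₀, hα₀, htr.eventually_nhds, hc.eventually (hφ.eventually (by simp)),
      hc'.eventually (hg₀.eventually (by simp))] with s h h' h'' hφs hgs
    exact hf₀.normalDeriv_eq hφs hgs h' h'' h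
  refine ⟨?_, ?_, ?_⟩
  · rw [← h₁.self_of_nhdsWithin self_mem_Ici, hf₁.apply_zero]
    exact htr.self_of_nhds
  · rw [hnd.self_of_nhds, hf₁.normalDeriv_eq hφ hg₁ hα₁ htr h₁]
  · rw [hf₀.normalDeriv₂_eq hφ hg₀ hα₀.self_of_nhds htr hnd h₀.self_of_nhds,
      hf₁.normalDeriv₂_eq hφ hg₁ hα₁ htr hnd h₁]

/-- Two `C²` functions extending the two spline functions have the same 2-jet on the interface if
the gluing conditions hold. -/
theorem jet_eq_of_gluingAt {ψ₀ ψ₁ : ℝ × ℝ → ℝ} (hf₀ : IsAdaptedPatch f₀ a c n α₀ β₀)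
    (hf₁ : IsAdaptedPatch f₁ a c n α₁ β₁) (hspan : ∀ v : ℝ × ℝ, ∃ x y : ℝ, v = x • n + y • c)
    (hψ₀ : ContDiffAt ℝ 2 ψ₀ (a + ξ • c)) (hψ₁ : ContDiffAt ℝ 2 ψ₁ (a + ξ • c))
    (hg₀ : ContDiffAt ℝ 2 g₀ (0, ξ)) (hg₁ : ContDiffAt ℝ 2 g₁ (0, ξ))
    (hα₀ : ∀ᶠ s in 𝓝 ξ, α₀ s ≠ 0) (hα₁ : ∀ᶠ s in 𝓝 ξ, α₁ s ≠ 0)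
    (h₀ : ∀ᶠ y in 𝓝 (0, ξ), ψ₀ (f₀ y) = g₀ y) (h₁ : ∀ᶠ y in 𝓝 (0, ξ), ψ₁ (f₁ y) = g₁ y)
    (hglue : ∀ᶠ s in 𝓝 ξ, GluingAt g₀ g₁ α₀ β₀ α₁ β₁ s) :
    ψ₀ (a + ξ • c) = ψ₁ (a + ξ • c) ∧ fderiv ℝ ψ₀ (a + ξ • c) = fderiv ℝ ψ₁ (a + ξ • c) ∧
      fderiv ℝ (fderiv ℝ ψ₀) (a + ξ • c) = fderiv ℝ (fderiv ℝ ψ₁) (a + ξ • c) := by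
  have hc : ContinuousAt (fun s : ℝ => a + s • c) ξ := by fun_prop
  have hc' : ContinuousAt (fun s : ℝ => ((0 : ℝ), s)) ξ := by fun_prop
  have hline : ∀ {ψ g : ℝ × ℝ → ℝ} {f : ℝ × ℝ → ℝ × ℝ}, (∀ᶠ y in 𝓝 (0, ξ), ψ (f y) = g y) →
      ∀ᶠ s in 𝓝 ξ, ∀ᶠ t in 𝓝[≥] (0 : ℝ), ψ (f (t, s)) = g (t, s) := fun {ψ g f} h => by
    filter_upwards [hc'.eventually h.eventually_nhds] with s hs
    have : ContinuousAt (fun t : ℝ => (t, s)) 0 := by fun_prop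
    exact (this.eventually hs).filter_mono nhdsWithin_le_nhds
  have htr₀ : (fun s => g₀ (0, s)) =ᶠ[𝓝 ξ] fun s => ψ₀ (a + s • c) := by
    filter_upwards [hc'.eventually h₀] with s hs
    rw [← hf₀.apply_zero, hs]
  have htr₁ : (fun s => g₀ (0, s)) =ᶠ[𝓝 ξ] fun s => ψ₁ (a + s • c) := by
    filter_upwards [hc'.eventually h₁, hglue] with s hs hs'
    rw [← hf₁.apply_zero, hs, hs'.1]
  have hnd₀ : normalDeriv g₀ α₀ β₀ (fun s => g₀ (0, s)) =ᶠ[𝓝 ξ]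
      fun s => fderiv ℝ ψ₀ (a + s • c) n := by
    filter_upwards [hline h₀, hα₀, htr₀.eventually_nhds, hc.eventually (hψ₀.eventually (by simp)),
      hc'.eventually (hg₀.eventually (by simp))] with s h h' h'' hφs hgs
    exact hf₀.normalDeriv_eq hφs hgs h' h'' h
  have hnd₁ : normalDeriv g₀ α₀ β₀ (fun s => g₀ (0, s)) =ᶠ[𝓝 ξ]
      fun s => fderiv ℝ ψ₁ (a + s • c) n := by
    filter_upwards [hline h₁, hα₁, htr₁.eventually_nhds, hc.eventually (hψ₁.eventually (by simp)),
      hc'.eventually (hg₁.eventually (by simp)), hglue] with s h h' h'' hφs hgs hs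
    rw [hs.2.1]
    exact hf₁.normalDeriv_eq hφs hgs h' h'' h
  have hdc : ∀ {ψ : ℝ × ℝ → ℝ}, ContDiffAt ℝ 2 ψ (a + ξ • c) →
      (fun s => g₀ (0, s)) =ᶠ[𝓝 ξ] (fun s => ψ (a + s • c)) →
      normalDeriv g₀ α₀ β₀ (fun s => g₀ (0, s)) =ᶠ[𝓝 ξ] (fun s => fderiv ℝ ψ (a + s • c) n) →
      fderiv ℝ ψ (a + ξ • c) c = deriv (fun s => g₀ (0, s)) ξ ∧
      fderiv ℝ (fderiv ℝ ψ) (a + ξ • c) c c = iteratedDeriv 2 (fun s => g₀ (0, s)) ξ ∧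
      fderiv ℝ (fderiv ℝ ψ) (a + ξ • c) c n =
        deriv (normalDeriv g₀ α₀ β₀ (fun s => g₀ (0, s))) ξ ∧
      fderiv ℝ (fderiv ℝ ψ) (a + ξ • c) n c = fderiv ℝ (fderiv ℝ ψ) (a + ξ • c) c n := by
    intro ψ hψ htr hnd
    have hd : DifferentiableAt ℝ (fderiv ℝ ψ) (a + ξ • c) :=
      (hψ.fderiv_right (m := 1) (by norm_num)).differentiableAt (by norm_num)
    refine ⟨?_, ?_, ?_, (hψ.isSymmSndFDerivAt (by simp)).eq n c⟩
    · rw [htr.deriv_eq, deriv_comp_add_smul (hψ.differentiableAt (by norm_num))]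
    · rw [htr.iteratedDeriv_eq, iteratedDeriv_two_comp_add_smul hψ]
    · rw [hnd.deriv_eq, deriv_comp_add_smul (f := fun x => fderiv ℝ ψ x n)
        (hd.clm_apply (differentiableAt_const _)),
        fderiv_clm_apply hd (differentiableAt_const _)]
      simp
  obtain ⟨c₀, cc₀, cn₀, nc₀⟩ := hdc hψ₀ htr₀ hnd₀
  obtain ⟨c₁, cc₁, cn₁, nc₁⟩ := hdc hψ₁ htr₁ hnd₁
  have hn : fderiv ℝ ψ₀ (a + ξ • c) n = fderiv ℝ ψ₁ (a + ξ • c) n :=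
    hnd₀.self_of_nhds.symm.trans hnd₁.self_of_nhds
  have hnn : fderiv ℝ (fderiv ℝ ψ₀) (a + ξ • c) n n = fderiv ℝ (fderiv ℝ ψ₁) (a + ξ • c) n n := by
    rw [← hf₀.normalDeriv₂_eq hψ₀ hg₀ hα₀.self_of_nhds htr₀ hnd₀ (hline h₀).self_of_nhds,
      ← hf₁.normalDeriv₂_eq hψ₁ hg₁ hα₁.self_of_nhds htr₁ hnd₁ (hline h₁).self_of_nhds]
    exact hglue.self_of_nhds.2.2
  refine ⟨htr₀.self_of_nhds.symm.trans htr₁.self_of_nhds, ?_, ?_⟩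
  · refine ContinuousLinearMap.ext fun v => ?_
    obtain ⟨x, y, rfl⟩ := hspan v
    simp only [map_add, map_smul, hn, c₀, c₁]
  · refine ContinuousLinearMap.ext fun v => ContinuousLinearMap.ext fun w => ?_
    obtain ⟨x, y, rfl⟩ := hspan v
    obtain ⟨x', y', rfl⟩ := hspan w
    simp only [map_add, map_smul, add_apply, smul_apply,
      hnn, nc₀, nc₁, cn₀, cn₁, cc₀, cc₁]

/-- A function given by two spline functions on the two sides of the interface is `C²` at an
interface point around which the gluing conditions hold. -/
theorem contDiffAt_of_gluingAt {φ X : ℝ × ℝ → ℝ} (hX : Continuous X)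
    (hXn : ∀ x y : ℝ, X (a + y • c + x • n) = x)
    (hspan : ∀ v : ℝ × ℝ, ∃ x y : ℝ, v = x • n + y • c)
    (hf₀ : IsAdaptedPatch f₀ a c n α₀ β₀) (hf₁ : IsAdaptedPatch f₁ a c n α₁ β₁)
    (hinv₀ : HasLocalInverse f₀ (0, ξ)) (hinv₁ : HasLocalInverse f₁ (0, ξ))
    (hg₀ : ContDiffAt ℝ 2 g₀ (0, ξ)) (hg₁ : ContDiffAt ℝ 2 g₁ (0, ξ))
    (hα₀ : ContinuousAt α₀ ξ) (hα₁ : ContinuousAt α₁ ξ) (hsign : α₀ ξ * α₁ ξ < 0)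
    (h₀ : ∀ᶠ y : ℝ × ℝ in 𝓝 (0, ξ), 0 ≤ y.1 → φ (f₀ y) = g₀ y)
    (h₁ : ∀ᶠ y : ℝ × ℝ in 𝓝 (0, ξ), 0 ≤ y.1 → φ (f₁ y) = g₁ y)
    (hglue : ∀ᶠ s in 𝓝 ξ, GluingAt g₀ g₁ α₀ β₀ α₁ β₁ s) :
    ContDiffAt ℝ 2 φ (a + ξ • c) := by
  have hXf : ∀ {f : ℝ × ℝ → ℝ × ℝ} {α β : ℝ → ℝ}, IsAdaptedPatch f a c n α β →
      ∀ y : ℝ × ℝ, X (f y) = y.1 * α y.2 := by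
    intro f α β hf y
    rw [← hXn (y.1 * α y.2) (y.2 + y.1 * β y.2), ← Prod.mk.eta (p := y), hf]
    congr 1
    module
  obtain ⟨k₀, hk₀, hq₀, hr₀, hl₀⟩ := hinv₀
  obtain ⟨k₁, hk₁, hq₁, hr₁, hl₁⟩ := hinv₁
  rw [hf₀.apply_zero] at hk₀ hq₀ hr₀
  rw [hf₁.apply_zero] at hk₁ hq₁ hr₁
  have hk₀t : Tendsto k₀ (𝓝 (a + ξ • c)) (𝓝 (0, ξ)) := by simpa [hq₀] using hk₀.continuousAt.tendsto
  have hk₁t : Tendsto k₁ (𝓝 (a + ξ • c)) (𝓝 (0, ξ)) := by simpa [hq₁] using hk₁.continuousAt.tendsto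
  have hs₀ : Tendsto (fun x => (k₀ x).2) (𝓝 (a + ξ • c)) (𝓝 ξ) :=
    (continuous_snd.tendsto ((0 : ℝ), ξ)).comp hk₀t
  have hs₁ : Tendsto (fun x => (k₁ x).2) (𝓝 (a + ξ • c)) (𝓝 ξ) :=
    (continuous_snd.tendsto ((0 : ℝ), ξ)).comp hk₁t
  have hc' : ContinuousAt (fun s : ℝ => ((0 : ℝ), s)) ξ := by fun_prop
  have hne₀ : α₀ ξ ≠ 0 := fun h => by simp [h] at hsign
  have hne₁ : α₁ ξ ≠ 0 := fun h => by simp [h] at hsign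
  have hψ₀ : ContDiffAt ℝ 2 (fun x => g₀ (k₀ x)) (a + ξ • c) :=
    ContDiffAt.comp (g := g₀) _ (by rwa [hq₀]) hk₀
  have hψ₁ : ContDiffAt ℝ 2 (fun x => g₁ (k₁ x)) (a + ξ • c) :=
    ContDiffAt.comp (g := g₁) _ (by rwa [hq₁]) hk₁
  have hpos : ∀ᶠ s in 𝓝 ξ, 0 < α₀ s * α₀ ξ :=
    continuousAt_const.eventually_lt (hα₀.mul continuousAt_const) (mul_self_pos.2 hne₀)
  have hneg : ∀ᶠ s in 𝓝 ξ, α₁ s * α₀ ξ < 0 :=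
    (hα₁.mul continuousAt_const).eventually_lt continuousAt_const (by rwa [mul_comm])
  have hjet : ∀ᶠ s in 𝓝 ξ, ContDiffAt ℝ 2 (fun x => g₀ (k₀ x)) (a + s • c) →
      ContDiffAt ℝ 2 (fun x => g₁ (k₁ x)) (a + s • c) →
      g₀ (k₀ (a + s • c)) = g₁ (k₁ (a + s • c)) ∧
      fderiv ℝ (fun x => g₀ (k₀ x)) (a + s • c) = fderiv ℝ (fun x => g₁ (k₁ x)) (a + s • c) ∧
      fderiv ℝ (fderiv ℝ fun x => g₀ (k₀ x)) (a + s • c) =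
        fderiv ℝ (fderiv ℝ fun x => g₁ (k₁ x)) (a + s • c) := by
    filter_upwards [hc'.eventually (hg₀.eventually (by simp)),
      hc'.eventually (hg₁.eventually (by simp)), (hα₀.eventually_ne hne₀).eventually_nhds,
      (hα₁.eventually_ne hne₁).eventually_nhds, hc'.eventually hl₀.eventually_nhds,
      hc'.eventually hl₁.eventually_nhds, hglue.eventually_nhds] with s e1 e2 e3 e4 e5 e6 e7 d0 d1
    exact jet_eq_of_gluingAt hf₀ hf₁ hspan d0 d1 e1 e2 e3 e4 (e5.mono fun y hy => by rw [hy])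
      (e6.mono fun y hy => by rw [hy]) e7
  obtain ⟨W, hW, hWo, hPW⟩ := mem_nhds_iff.1 (hr₀.and (hr₁.and ((hk₀t.eventually h₀).and
    ((hk₁t.eventually h₁).and ((hs₀.eventually hpos).and ((hs₁.eventually hneg).and
    ((hs₀.eventually hjet).and ((hψ₀.eventually (by simp)).and
      (hψ₁.eventually (by simp))))))))))
  have hjetW : ∀ x ∈ W, X x * α₀ ξ = 0 → g₀ (k₀ x) = g₁ (k₁ x) ∧
      fderiv ℝ (fun x => g₀ (k₀ x)) x = fderiv ℝ (fun x => g₁ (k₁ x)) x ∧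
      fderiv ℝ (fderiv ℝ fun x => g₀ (k₀ x)) x = fderiv ℝ (fderiv ℝ fun x => g₁ (k₁ x)) x := by
    intro x hx hXx
    obtain ⟨e1, -, -, -, e5, -, e7, e8, e9⟩ := hW hx
    have hxt : (k₀ x).1 = 0 := by
      rw [← e1, hXf hf₀, mul_assoc, mul_eq_zero] at hXx
      exact hXx.resolve_right e5.ne'
    have hxe : x = a + (k₀ x).2 • c := by
      rw [← hf₀.apply_zero, ← hxt, Prod.mk.eta, e1]
    rw [← hxe] at e7
    exact e7 e8 e9
  have hWc₀ : ∀ x ∈ W, ContDiffAt ℝ 2 (fun x => g₀ (k₀ x)) x := fun x hx =>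
    (hW hx).2.2.2.2.2.2.2.1
  have hWc₁ : ∀ x ∈ W, ContDiffAt ℝ 2 (fun x => g₁ (k₁ x)) x := fun x hx =>
    (hW hx).2.2.2.2.2.2.2.2
  have hfd : ∀ x ∈ W, fderiv ℝ (fun x => g₁ (k₁ x) - g₀ (k₀ x)) x =
      fderiv ℝ (fun x => g₁ (k₁ x)) x - fderiv ℝ (fun x => g₀ (k₀ x)) x := fun x hx =>
    fderiv_fun_sub ((hWc₁ x hx).differentiableAt (by norm_num))
      ((hWc₀ x hx).differentiableAt (by norm_num))
  have hfdd : ∀ x ∈ W, fderiv ℝ (fderiv ℝ fun x => g₁ (k₁ x) - g₀ (k₀ x)) x =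
      fderiv ℝ (fderiv ℝ fun x => g₁ (k₁ x)) x - fderiv ℝ (fderiv ℝ fun x => g₀ (k₀ x)) x := by
    intro x hx
    have : fderiv ℝ (fun x => g₁ (k₁ x) - g₀ (k₀ x)) =ᶠ[𝓝 x] fun x =>
        fderiv ℝ (fun x => g₁ (k₁ x)) x - fderiv ℝ (fun x => g₀ (k₀ x)) x := by
      filter_upwards [hWo.mem_nhds hx] with y hy using hfd y hy
    rw [this.fderiv_eq]
    exact fderiv_fun_sub
      (((hWc₁ x hx).fderiv_right (m := 1) (by norm_num)).differentiableAt (by norm_num))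
      (((hWc₀ x hx).fderiv_right (m := 1) (by norm_num)).differentiableAt (by norm_num))
  have hind : ContDiffOn ℝ 2 ({x | X x * α₀ ξ ≤ 0}.indicator
      fun x => g₁ (k₁ x) - g₀ (k₀ x)) W := by
    refine contDiffOn_two_indicator_nonpos (X := fun x => X x * α₀ ξ) (by fun_prop) hWo
      (fun x hx => ((hWc₁ x hx).sub (hWc₀ x hx)).contDiffWithinAt) ?_ ?_ ?_
    · intro x hx h
      rw [(hjetW x hx h).1, sub_self]
    · intro x hx h
      rw [hfd x hx, (hjetW x hx h).2.1, sub_self]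
    · intro x hx h
      rw [hfdd x hx, (hjetW x hx h).2.2]
      exact sub_self _
  refine (hψ₀.add (hind.contDiffAt (hWo.mem_nhds hPW))).congr_of_eventuallyEq ?_
  filter_upwards [hWo.mem_nhds hPW] with x hx
  obtain ⟨e1, e2, e3, e4, e5, e6, -⟩ := hW hx
  by_cases hZ : X x * α₀ ξ ≤ 0
  · rw [indicator_of_mem (show x ∈ {x | X x * α₀ ξ ≤ 0} from hZ),
      add_sub_cancel, ← e4 ?_, e2]
    rw [← e2, hXf hf₁, mul_assoc] at hZ
    by_contra! hlt
    exact absurd (mul_pos_of_neg_of_neg hlt e6) hZ.not_gt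
  · rw [indicator_of_notMem (show x ∉ {x | X x * α₀ ξ ≤ 0} from hZ),
      add_zero, ← e3 ?_, e1]
    rw [← e1, hXf hf₀, mul_assoc, not_le] at hZ
    exact (pos_of_mul_pos_left hZ e5.le).le

theorem contDiffAt_normalDeriv {g : ℝ × ℝ → ℝ} {α β γ : ℝ → ℝ} (hg : ContDiffAt ℝ 2 g (0, ξ))
    (hα : ContDiffAt ℝ 1 α ξ) (hβ : ContDiffAt ℝ 1 β ξ) (hγ : ContDiffAt ℝ 2 γ ξ)
    (hne : α ξ ≠ 0) : ContDiffAt ℝ 1 (normalDeriv g α β γ) ξ := by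
  have hc' : ContinuousAt (fun s : ℝ => ((0 : ℝ), s)) ξ := by fun_prop
  have h1 : ContDiffAt ℝ 1 (fun s => fderiv ℝ g (0, s) (1, 0)) ξ :=
    (ContDiffAt.comp (g := fderiv ℝ g) ξ (hg.fderiv_right (by norm_num))
      (by fun_prop)).clm_apply contDiffAt_const
  have h2 : ContDiffAt ℝ 1 (fun s => deriv (fun t => g (t, s)) 0) ξ := by
    refine h1.congr_of_eventuallyEq ?_
    filter_upwards [hc'.eventually (hg.eventually (by simp))] with s hs
    simpa using deriv_comp_add_smul (f := g) (p := (0, s)) (v := (1, 0)) (r := 0)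
      (by simpa using hs.differentiableAt (by norm_num))
  have h3 : ContDiffAt ℝ 1 (deriv γ) ξ := by
    have := (hγ.fderiv_right (m := 1) (by norm_num)).clm_apply (contDiffAt_const (c := (1 : ℝ)))
    simpa only [fderiv_apply_one_eq_deriv] using this
  exact (h2.sub (hβ.mul h3)).div hα hne

theorem continuousAt_normalDeriv₂ {g : ℝ × ℝ → ℝ} {α β γ δ : ℝ → ℝ}
    (hg : ContDiffAt ℝ 2 g (0, ξ)) (hα : ContinuousAt α ξ) (hβ : ContinuousAt β ξ)
    (hγ : ContDiffAt ℝ 2 γ ξ) (hδ : ContDiffAt ℝ 1 δ ξ) (hne : α ξ ≠ 0) :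
    ContinuousAt (normalDeriv₂ g α β γ δ) ξ := by
  have hc' : ContinuousAt (fun s : ℝ => ((0 : ℝ), s)) ξ := by fun_prop
  have hg' : ContDiffAt ℝ 0 (fderiv ℝ (fderiv ℝ g)) (0, ξ) :=
    (hg.fderiv_right (m := 1) (by norm_num)).fderiv_right (by norm_num)
  have h1 : ContinuousAt (fun s => fderiv ℝ (fderiv ℝ g) (0, s) (1, 0) (1, 0)) ξ :=
    ((ContinuousAt.comp (g := fderiv ℝ (fderiv ℝ g)) hg'.continuousAt hc').clm_apply
      continuousAt_const).clm_apply continuousAt_const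
  have h2 : ContinuousAt (fun s => iteratedDeriv 2 (fun t => g (t, s)) 0) ξ := by
    refine h1.congr_of_eventuallyEq ?_
    filter_upwards [hc'.eventually (hg.eventually (by simp))] with s hs
    simpa using iteratedDeriv_two_comp_add_smul (f := g) (p := (0, s)) (v := (1, 0)) (r := 0)
      (by simpa using hs)
  have h3 : ContDiffAt ℝ 1 (deriv γ) ξ := by
    have := (hγ.fderiv_right (m := 1) (by norm_num)).clm_apply (contDiffAt_const (c := (1 : ℝ)))
    simpa only [fderiv_apply_one_eq_deriv] using this
  have h4 : ∀ {ε : ℝ → ℝ}, ContDiffAt ℝ 1 ε ξ → ContinuousAt (deriv ε) ξ := fun {ε} h => by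
    have := ((h.fderiv_right (m := 0) (by norm_num)).clm_apply
      (contDiffAt_const (c := (1 : ℝ)))).continuousAt
    simpa only [fderiv_apply_one_eq_deriv] using this
  have h5 : ContinuousAt (iteratedDeriv 2 γ) ξ := by
    rw [iteratedDeriv_succ, iteratedDeriv_one]
    exact h4 h3
  exact ((h2.sub ((hβ.pow 2).mul h5)).sub (((continuousAt_const.mul hα).mul hβ).mul
    (h4 hδ))).div (hα.pow 2) (pow_ne_zero 2 hne)

/-- By continuity, the gluing conditions extend to the endpoints of the interface. -/
theorem gluingAt_Icc_of_Ioo (hg₀ : ∀ s ∈ Icc (0 : ℝ) 1, ContDiffAt ℝ 2 g₀ (0, s))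
    (hg₁ : ∀ s ∈ Icc (0 : ℝ) 1, ContDiffAt ℝ 2 g₁ (0, s))
    (hα₀ : ContDiff ℝ 1 α₀) (hβ₀ : ContDiff ℝ 1 β₀) (hα₁ : ContDiff ℝ 1 α₁)
    (hβ₁ : ContDiff ℝ 1 β₁) (hne₀ : ∀ s ∈ Icc (0 : ℝ) 1, α₀ s ≠ 0)
    (hne₁ : ∀ s ∈ Icc (0 : ℝ) 1, α₁ s ≠ 0)
    (h : ∀ s ∈ Ioo (0 : ℝ) 1, GluingAt g₀ g₁ α₀ β₀ α₁ β₁ s) :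
    ∀ s ∈ Icc (0 : ℝ) 1, GluingAt g₀ g₁ α₀ β₀ α₁ β₁ s := by
  have hext : ∀ {p q : ℝ → ℝ}, (∀ s ∈ Icc (0 : ℝ) 1, ContinuousAt p s) →
      (∀ s ∈ Icc (0 : ℝ) 1, ContinuousAt q s) → EqOn p q (Ioo 0 1) → EqOn p q (Icc 0 1) :=
    fun hp hq he => he.of_subset_closure (fun s hs => (hp s hs).continuousWithinAt)
      (fun s hs => (hq s hs).continuousWithinAt) Ioo_subset_Icc_self
      (closure_Ioo zero_ne_one).ge
  have htr : ∀ {g : ℝ × ℝ → ℝ}, (∀ s ∈ Icc (0 : ℝ) 1, ContDiffAt ℝ 2 g (0, s)) →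
      ∀ s ∈ Icc (0 : ℝ) 1, ContDiffAt ℝ 2 (fun s => g (0, s)) s :=
    fun {g} hg s hs => ContDiffAt.comp (g := g) s (hg s hs) (by fun_prop)
  have hnd : ∀ s ∈ Icc (0 : ℝ) 1,
      ContDiffAt ℝ 1 (normalDeriv g₀ α₀ β₀ fun s => g₀ (0, s)) s := fun s hs =>
    contDiffAt_normalDeriv (hg₀ s hs) hα₀.contDiffAt hβ₀.contDiffAt (htr hg₀ s hs) (hne₀ s hs)
  have h1 := hext (fun s hs => (htr hg₀ s hs).continuousAt)
    (fun s hs => (htr hg₁ s hs).continuousAt) fun s hs => (h s hs).1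
  have h2 := hext (fun s hs => (hnd s hs).continuousAt)
    (fun s hs => (contDiffAt_normalDeriv (hg₁ s hs) hα₁.contDiffAt hβ₁.contDiffAt (htr hg₀ s hs)
      (hne₁ s hs)).continuousAt) fun s hs => (h s hs).2.1
  have h3 := hext
    (fun s hs => continuousAt_normalDeriv₂ (hg₀ s hs) hα₀.continuous.continuousAt
      hβ₀.continuous.continuousAt (htr hg₀ s hs) (hnd s hs) (hne₀ s hs))
    (fun s hs => continuousAt_normalDeriv₂ (hg₁ s hs) hα₁.continuous.continuousAt
      hβ₁.continuous.continuousAt (htr hg₀ s hs) (hnd s hs) (hne₁ s hs))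
    fun s hs => (h s hs).2.2
  exact fun s hs => ⟨h1 hs, h2 hs, h3 hs⟩

end TwoPatches

theorem IsPreconnected.pos_or_neg_of_ne_zero {E : Type*} [TopologicalSpace E] {s : Set E}
    (hs : IsPreconnected s) {f : E → ℝ} (hf : ContinuousOn f s) (hne : ∀ x ∈ s, f x ≠ 0) :
    (∀ x ∈ s, 0 < f x) ∨ ∀ x ∈ s, f x < 0 := by
  by_contra! h
  obtain ⟨⟨x, hx, hfx⟩, y, hy, hfy⟩ := h
  obtain ⟨z, hz, hfz⟩ := hs.intermediate_value hx hy hf ⟨hfx, hfy⟩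
  exact hne z hz hfz

/-- The map `f` is bilinear with coefficients `a, b, c, d`. -/
def IsBilinearPatch (f : ℝ × ℝ → ℝ × ℝ) (a b c d : ℝ × ℝ) : Prop :=
  ∀ ξ : ℝ × ℝ, f ξ = a + ξ.1 • b + ξ.2 • c + (ξ.1 * ξ.2) • d

/-- The determinant of two plane vectors. -/
def planeDet (u v : ℝ × ℝ) : ℝ := u.1 * v.2 - u.2 * v.1

namespace IsBilinearPatch

variable {f : ℝ × ℝ → ℝ × ℝ} {a b c d : ℝ × ℝ}

theorem contDiff (hf : IsBilinearPatch f a b c d) : ContDiff ℝ 2 f := by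
  rw [show f = _ from funext hf]
  fun_prop

theorem deriv_left (hf : IsBilinearPatch f a b c d) (ξ : ℝ) :
    deriv (fun t => f (t, ξ)) 0 = b + ξ • d := by
  have : (fun t => f (t, ξ)) = fun t => (a + ξ • c) + t • (b + ξ • d) := by
    ext t : 1
    rw [hf]
    module
  rw [this]
  simpa using (((hasDerivAt_id (0 : ℝ)).smul_const (b + ξ • d)).const_add (a + ξ • c)).deriv

theorem deriv_right (hf : IsBilinearPatch f a b c d) (ξ : ℝ) :
    deriv (fun t => f (0, t)) ξ = c := by
  have : (fun t => f (0, t)) = fun t => a + t • c := by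
    ext t : 1
    rw [hf]
    module
  rw [this]
  simpa using (((hasDerivAt_id ξ).smul_const c).const_add a).deriv

theorem hasLocalInverse (hf : IsBilinearPatch f a b c d) {q : ℝ × ℝ}
    (hq : planeDet (b + q.2 • d) (c + q.1 • d) ≠ 0) : HasLocalInverse f q := by
  have hd : HasFDerivAt f ((ContinuousLinearMap.fst ℝ ℝ ℝ).smulRight (b + q.2 • d) +
      (ContinuousLinearMap.snd ℝ ℝ ℝ).smulRight (c + q.1 • d)) q := by
    rw [show f = _ from funext hf]
    have h1 : HasFDerivAt (fun ξ : ℝ × ℝ => ξ.1) (ContinuousLinearMap.fst ℝ ℝ ℝ) q :=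
      hasFDerivAt_fst
    have h2 : HasFDerivAt (fun ξ : ℝ × ℝ => ξ.2) (ContinuousLinearMap.snd ℝ ℝ ℝ) q :=
      hasFDerivAt_snd
    refine (((h1.smul_const b).const_add a).add (h2.smul_const c)).add
      ((h1.mul h2).smul_const d) |>.congr_fderiv ?_
    refine ContinuousLinearMap.ext fun v => ?_
    simp
    ext <;> simp <;> ring
  refine hd.hasLocalInverse hf.contDiff.contDiffAt ?_
  rw [injective_iff_map_eq_zero]
  intro v hv
  obtain ⟨e1, e2⟩ := Prod.ext_iff.1 hv
  simp only [planeDet, Prod.fst_add, Prod.snd_add, Prod.smul_fst, Prod.smul_snd,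
    smul_eq_mul] at hq
  simp at e1 e2
  refine Prod.ext ?_ ?_
  · refine (mul_eq_zero.1 ?_).resolve_right hq
    linear_combination (c.2 + q.1 * d.2) * e1 - (c.1 + q.1 * d.1) * e2
  · refine (mul_eq_zero.1 ?_).resolve_right hq
    linear_combination (b.1 + q.2 * d.1) * e2 - (b.2 + q.2 * d.2) * e1

/-- An injective bilinear map has nonvanishing Jacobian. -/
theorem planeDet_ne_zero (hf : IsBilinearPatch f a b c d) {s : Set (ℝ × ℝ)} (hinj : InjOn f s)
    {q : ℝ × ℝ} (hs : s ∈ 𝓝 q) : planeDet (b + q.2 • d) (c + q.1 • d) ≠ 0 := by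
  intro hdet
  set u := b + q.2 • d with hu
  set v := c + q.1 • d with hv
  have hfs : ∀ x y : ℝ, f (q.1 + x, q.2 + y) = f q + x • u + y • v + (x * y) • d := by
    intro x y
    rw [hf, hf, hu, hv]
    module
  have hxy : ∀ x y : ℝ, (x, y) ≠ 0 → x • u = y • v → False := by
    intro x y hne hxy
    have t1 : ∀ᶠ r : ℝ in 𝓝[≠] 0, (q.1 + r * x, q.2) ∈ s := by
      refine Filter.Eventually.filter_mono nhdsWithin_le_nhds ?_
      have : ContinuousAt (fun r : ℝ => (q.1 + r * x, q.2)) 0 := by fun_prop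
      exact this.eventually_mem (by simpa using hs)
    have t2 : ∀ᶠ r : ℝ in 𝓝[≠] 0, (q.1, q.2 + r * y) ∈ s := by
      refine Filter.Eventually.filter_mono nhdsWithin_le_nhds ?_
      have : ContinuousAt (fun r : ℝ => (q.1, q.2 + r * y)) 0 := by fun_prop
      exact this.eventually_mem (by simpa using hs)
    obtain ⟨r, ⟨h1, h2⟩, hr : r ≠ 0⟩ := ((t1.and t2).and self_mem_nhdsWithin).exists
    have e := hinj h1 h2 (by
      have e1 := hfs (r * x) 0
      have e2 := hfs 0 (r * y)
      rw [add_zero] at e1 e2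
      rw [e1, e2, mul_smul, mul_smul, hxy]
      module)
    simp [hr] at e
    exact hne (by simp [e])
  simp only [planeDet] at hdet
  by_cases hv0 : v = 0
  · exact hxy 0 1 (by simp) (by simp [hv0])
  by_cases h1 : v.1 = 0
  · have h2 : v.2 ≠ 0 := fun h => hv0 (Prod.ext h1 h)
    refine hxy v.2 u.2 (by simp [h2]) (Prod.ext ?_ ?_) <;> simp <;> first | ring1 | linear_combination hdet
  · refine hxy v.1 u.1 (by simp [h1]) (Prod.ext ?_ ?_) <;> simp <;> first | ring1 | linear_combination -hdet

theorem isAdaptedPatch (hf : IsBilinearPatch f a b c d) {c₁ : ℝ} (hc₁ : c₁ ≠ 0)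
    (hc : c.1 ^ 2 + c.2 ^ 2 ≠ 0) :
    IsAdaptedPatch f a c ((c₁ * (c.1 ^ 2 + c.2 ^ 2))⁻¹ • (c.2, -c.1))
      (fun s => c₁ * planeDet (b + s • d) c)
      (fun s => ((b + s • d).1 * c.1 + (b + s • d).2 * c.2) / (c.1 ^ 2 + c.2 ^ 2)) := by
  intro t s
  rw [hf]
  simp only [planeDet]
  refine Prod.ext ?_ ?_ <;> simp <;> field_simp <;> ring

end IsBilinearPatch

theorem exists_glued_function {A B C : Type*} [Nonempty A] {f₀ f₁ : A → B} {g₀ g₁ : A → C}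
    {s : Set A} (h₀ : InjOn f₀ s) (h₁ : InjOn f₁ s)
    (h : ∀ x ∈ s, ∀ y ∈ s, f₀ x = f₁ y → g₀ x = g₁ y) :
    ∃ φ : B → C, (∀ x ∈ s, φ (f₀ x) = g₀ x) ∧ ∀ x ∈ s, φ (f₁ x) = g₁ x := by
  classical
  refine ⟨fun z => if z ∈ f₀ '' s then g₀ (Function.invFunOn f₀ s z)
    else g₁ (Function.invFunOn f₁ s z), fun x hx => ?_, fun x hx => ?_⟩
  · simp only [if_pos (mem_image_of_mem f₀ hx), h₀.leftInvOn_invFunOn hx]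
  · by_cases hx' : f₁ x ∈ f₀ '' s
    · obtain ⟨y, hy, hyx⟩ := hx'
      simp only [← hyx, if_pos (mem_image_of_mem f₀ hy), h₀.leftInvOn_invFunOn hy]
      exact h y hy x hx hyx
    · simp only [if_neg hx', h₁.leftInvOn_invFunOn hx]

end IsogeometricGluing

/-- For two bilinear patches `F⁰, F¹` sharing the interface
`Γ = F⁰({0}×(0,1)) = F¹({0}×(0,1))`, the piecewise isogeometric function
`φ(x) = gᵗ((Fᵗ)⁻¹(x))` on `Ω = Ω⁰ ∪ Γ ∪ Ω¹` is well defined and twice continuously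
differentiable on `Ω` if and only if the `G²`-gluing conditions (i)–(iii) hold for all
`ξ ∈ [0,1]`, with `g₀(ξ) = g⁰(0,ξ)` and
`g₁(ξ) = (∂₁g⁰(0,ξ) − β⁰(ξ)·g₀′(ξ))/α⁰(ξ)`. -/
theorem isogeometric_C2_iff_G2
    (a0 b0 c0 d0 a1 b1 c1v d1v : ℝ × ℝ) (F0 F1 : ℝ × ℝ → ℝ × ℝ)
    (hF0 : ∀ ξ : ℝ × ℝ, F0 ξ = a0 + ξ.1 • b0 + ξ.2 • c0 + (ξ.1 * ξ.2) • d0)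
    (hF1 : ∀ ξ : ℝ × ℝ, F1 ξ = a1 + ξ.1 • b1 + ξ.2 • c1v + (ξ.1 * ξ.2) • d1v)
    (hinj0 : InjOn F0 (Icc 0 1 ×ˢ Icc 0 1))
    (hinj1 : InjOn F1 (Icc 0 1 ×ˢ Icc 0 1))
    (hiface : ∀ ξ ∈ Icc (0:ℝ) 1, F0 (0, ξ) = F1 (0, ξ))
    (Ω0 Ω1 Γ Ω : Set (ℝ × ℝ))
    (hΩ0 : Ω0 = F0 '' (Ioo 0 1 ×ˢ Ioo 0 1))
    (hΩ1 : Ω1 = F1 '' (Ioo 0 1 ×ˢ Ioo 0 1))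
    (hΓ : Γ = F0 '' (({0} : Set ℝ) ×ˢ Ioo 0 1))
    (hdisj : Ω0 ∩ Ω1 = ∅)
    (hΩ : Ω = Ω0 ∪ Γ ∪ Ω1)
    (hopen : IsOpen Ω)
    (c₁ : ℝ) (hc₁ : c₁ ≠ 0)
    (α0 α1 β0 β1 : ℝ → ℝ)
    (hα0 : ∀ ξ : ℝ, α0 ξ = c₁ *
      ((deriv (fun t => F0 (t, ξ)) 0).1 * (deriv (fun t => F0 (0, t)) ξ).2 -
        (deriv (fun t => F0 (t, ξ)) 0).2 * (deriv (fun t => F0 (0, t)) ξ).1))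
    (hα1 : ∀ ξ : ℝ, α1 ξ = c₁ *
      ((deriv (fun t => F1 (t, ξ)) 0).1 * (deriv (fun t => F1 (0, t)) ξ).2 -
        (deriv (fun t => F1 (t, ξ)) 0).2 * (deriv (fun t => F1 (0, t)) ξ).1))
    (hβ0 : ∀ ξ : ℝ, β0 ξ =
      ((deriv (fun t => F0 (t, ξ)) 0).1 * (deriv (fun t => F0 (0, t)) ξ).1 +
        (deriv (fun t => F0 (t, ξ)) 0).2 * (deriv (fun t => F0 (0, t)) ξ).2) /
      ((deriv (fun t => F0 (0, t)) ξ).1 ^ 2 + (deriv (fun t => F0 (0, t)) ξ).2 ^ 2))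
    (hβ1 : ∀ ξ : ℝ, β1 ξ =
      ((deriv (fun t => F1 (t, ξ)) 0).1 * (deriv (fun t => F1 (0, t)) ξ).1 +
        (deriv (fun t => F1 (t, ξ)) 0).2 * (deriv (fun t => F1 (0, t)) ξ).2) /
      ((deriv (fun t => F1 (0, t)) ξ).1 ^ 2 + (deriv (fun t => F1 (0, t)) ξ).2 ^ 2))
    (hα0ne : ∀ ξ ∈ Icc (0:ℝ) 1, α0 ξ ≠ 0)
    (hα1ne : ∀ ξ ∈ Icc (0:ℝ) 1, α1 ξ ≠ 0)
    (g0 g1 : ℝ × ℝ → ℝ) (U : Set (ℝ × ℝ)) (hU : IsOpen U)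
    (hUsq : (Icc 0 1 ×ˢ Icc 0 1 : Set (ℝ × ℝ)) ⊆ U)
    (hg0 : ContDiffOn ℝ 2 g0 U) (hg1 : ContDiffOn ℝ 2 g1 U) :
    (∃ φ : ℝ × ℝ → ℝ, ContDiffOn ℝ 2 φ Ω ∧
        (∀ ξ : ℝ × ℝ, ξ ∈ (Ioo 0 1 ×ˢ Ioo 0 1 ∪ ({0} : Set ℝ) ×ˢ Ioo 0 1 : Set (ℝ × ℝ)) →
          φ (F0 ξ) = g0 ξ) ∧
        (∀ ξ : ℝ × ℝ, ξ ∈ (Ioo 0 1 ×ˢ Ioo 0 1 ∪ ({0} : Set ℝ) ×ˢ Ioo 0 1 : Set (ℝ × ℝ)) →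
          φ (F1 ξ) = g1 ξ)) ↔
    (∀ ξ ∈ Icc (0:ℝ) 1,
      -- (i) matching traces
      g0 (0, ξ) = g1 (0, ξ) ∧
      -- (ii) matching first transversal derivatives
      (deriv (fun t => g0 (t, ξ)) 0 - β0 ξ * deriv (fun s => g0 (0, s)) ξ) / α0 ξ =
        (deriv (fun t => g1 (t, ξ)) 0 - β1 ξ * deriv (fun s => g0 (0, s)) ξ) / α1 ξ ∧
      -- (iii) matching second transversal derivatives
      (iteratedDeriv 2 (fun t => g0 (t, ξ)) 0 -
          (β0 ξ) ^ 2 * iteratedDeriv 2 (fun s => g0 (0, s)) ξ -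
          2 * α0 ξ * β0 ξ *
            deriv (fun s =>
              (deriv (fun t => g0 (t, s)) 0 - β0 s * deriv (fun v => g0 (0, v)) s) / α0 s) ξ) /
        (α0 ξ) ^ 2 =
      (iteratedDeriv 2 (fun t => g1 (t, ξ)) 0 -
          (β1 ξ) ^ 2 * iteratedDeriv 2 (fun s => g0 (0, s)) ξ -
          2 * α1 ξ * β1 ξ *
            deriv (fun s =>
              (deriv (fun t => g0 (t, s)) 0 - β0 s * deriv (fun v => g0 (0, v)) s) / α0 s) ξ) /
        (α1 ξ) ^ 2) := by
  have e0 : a0 = a1 := by simpa [hF0, hF1] using hiface 0 (by simp)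
  subst e0
  have e1 : c0 = c1v := by simpa [hF0, hF1] using hiface 1 (by simp)
  subst e1
  have hB0 : IsBilinearPatch F0 a0 b0 c0 d0 := hF0
  have hB1 : IsBilinearPatch F1 a0 b1 c0 d1v := hF1
  simp only [hB0.deriv_left, hB0.deriv_right] at hα0 hβ0
  simp only [hB1.deriv_left, hB1.deriv_right] at hα1 hβ1
  have hN : c0.1 ^ 2 + c0.2 ^ 2 ≠ 0 := by
    intro h
    have h1 : c0.1 = 0 := by nlinarith [sq_nonneg c0.1, sq_nonneg c0.2]
    have h2 : c0.2 = 0 := by nlinarith [sq_nonneg c0.1, sq_nonneg c0.2]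
    exact hα0ne 0 (by simp) (by rw [hα0, h1, h2]; simp)
  have hA0 := hB0.isAdaptedPatch hc₁ hN
  have hA1 := hB1.isAdaptedPatch hc₁ hN
  set n : ℝ × ℝ := (c₁ * (c0.1 ^ 2 + c0.2 ^ 2))⁻¹ • (c0.2, -c0.1) with hn
  obtain rfl := funext hα0
  obtain rfl := funext hα1
  obtain rfl := funext hβ0
  obtain rfl := funext hβ1
  set α0 : ℝ → ℝ := fun ξ => c₁ * ((b0 + ξ • d0).1 * c0.2 - (b0 + ξ • d0).2 * c0.1) with hα0d
  set α1 : ℝ → ℝ := fun ξ => c₁ * ((b1 + ξ • d1v).1 * c0.2 - (b1 + ξ • d1v).2 * c0.1) with hα1d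
  set β0 : ℝ → ℝ := fun ξ => ((b0 + ξ • d0).1 * c0.1 + (b0 + ξ • d0).2 * c0.2) /
    (c0.1 ^ 2 + c0.2 ^ 2) with hβ0d
  set β1 : ℝ → ℝ := fun ξ => ((b1 + ξ • d1v).1 * c0.1 + (b1 + ξ • d1v).2 * c0.2) /
    (c0.1 ^ 2 + c0.2 ^ 2) with hβ1d
  change IsAdaptedPatch F0 a0 c0 n α0 β0 at hA0
  change IsAdaptedPatch F1 a0 c0 n α1 β1 at hA1
  have hcα0 : ContDiff ℝ 1 α0 := by fun_prop
  have hcα1 : ContDiff ℝ 1 α1 := by fun_prop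
  have hcβ0 : ContDiff ℝ 1 β0 := by fun_prop
  have hcβ1 : ContDiff ℝ 1 β1 := by fun_prop
  have hgc : ∀ {g : ℝ × ℝ → ℝ}, ContDiffOn ℝ 2 g U →
      ∀ y ∈ (Icc 0 1 ×ˢ Icc 0 1 : Set (ℝ × ℝ)), ContDiffAt ℝ 2 g y :=
    fun hg y hy => hg.contDiffAt (hU.mem_nhds (hUsq hy))
  have hgc0 : ∀ {g : ℝ × ℝ → ℝ}, ContDiffOn ℝ 2 g U →
      ∀ s ∈ Icc (0 : ℝ) 1, ContDiffAt ℝ 2 g (0, s) :=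
    fun hg s hs => hgc hg _ ⟨by simp, hs⟩
  have hS : (Ioo 0 1 ×ˢ Ioo 0 1 ∪ ({0} : Set ℝ) ×ˢ Ioo 0 1 : Set (ℝ × ℝ)) =
      Ico 0 1 ×ˢ Ioo 0 1 := by
    rw [← union_prod, union_singleton, Ioo_insert_left zero_lt_one]
  have hSsub : (Ico 0 1 ×ˢ Ioo 0 1 : Set (ℝ × ℝ)) ⊆ Icc 0 1 ×ˢ Icc 0 1 :=
    prod_mono Ico_subset_Icc_self Ioo_subset_Icc_self
  have hQsub : (Ioo 0 1 ×ˢ Ioo 0 1 : Set (ℝ × ℝ)) ⊆ Icc 0 1 ×ˢ Icc 0 1 :=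
    prod_mono Ioo_subset_Icc_self Ioo_subset_Icc_self
  have hPt : ∀ s ∈ Ioo (0 : ℝ) 1, a0 + s • c0 ∈ Ω := by
    intro s hs
    rw [hΩ, hΓ]
    exact .inl (.inr ⟨(0, s), ⟨rfl, hs⟩, hA0.apply_zero s⟩)
  simp only [hS]
  change _ ↔ ∀ ξ ∈ Icc (0 : ℝ) 1, GluingAt g0 g1 α0 β0 α1 β1 ξ
  constructor
  · rintro ⟨φ, hφ, h0, h1⟩
    refine gluingAt_Icc_of_Ioo (hgc0 hg0) (hgc0 hg1) hcα0 hcβ0 hcα1 hcβ1 hα0ne hα1ne ?_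
    intro s hs
    refine gluingAt_of_contDiffAt hA0 hA1 (hφ.contDiffAt (hopen.mem_nhds (hPt s hs)))
      (hgc0 hg0 s (Ioo_subset_Icc_self hs)) (hgc0 hg1 s (Ioo_subset_Icc_self hs))
      (hcα0.continuous.continuousAt.eventually_ne (hα0ne s (Ioo_subset_Icc_self hs)))
      (hα1ne s (Ioo_subset_Icc_self hs)) ?_ ?_
    · filter_upwards [isOpen_Ioo.mem_nhds hs] with s' hs'
      filter_upwards [Ico_mem_nhdsGE zero_lt_one] with t ht using h0 _ ⟨ht, hs'⟩
    · filter_upwards [Ico_mem_nhdsGE zero_lt_one] with t ht using h1 _ ⟨ht, hs⟩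
  · intro hglue
    set X : ℝ × ℝ → ℝ := fun z => c₁ * planeDet (z - a0) c0 with hXd
    have hX : Continuous X := by
      simp only [hXd, planeDet]
      fun_prop
    have hXn : ∀ x y : ℝ, X (a0 + y • c0 + x • n) = x := by
      intro x y
      simp [hXd, planeDet, hn]
      field_simp
      ring
    have hspan : ∀ v : ℝ × ℝ, ∃ x y : ℝ, v = x • n + y • c0 := by
      intro v
      refine ⟨c₁ * planeDet v c0, (v.1 * c0.1 + v.2 * c0.2) / (c0.1 ^ 2 + c0.2 ^ 2), ?_⟩
      refine Prod.ext ?_ ?_ <;> simp [planeDet, hn] <;> field_simp <;> ring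
    have hXf : ∀ {f : ℝ × ℝ → ℝ × ℝ} {α β : ℝ → ℝ}, IsAdaptedPatch f a0 c0 n α β →
        ∀ y : ℝ × ℝ, X (f y) = y.1 * α y.2 := by
      intro f α β hf y
      rw [← hXn (y.1 * α y.2) (y.2 + y.1 * β y.2), ← Prod.mk.eta (p := y), hf]
      congr 1
      module
    have hΩS : ∀ z ∈ Ω, ∃ y ∈ (Ico 0 1 ×ˢ Ioo 0 1 : Set (ℝ × ℝ)), F0 y = z ∨ F1 y = z := by
      intro z hz
      rw [hΩ, hΩ0, hΩ1, hΓ, ← image_union, hS] at hz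
      rcases hz with ⟨y, hy, hyz⟩ | ⟨y, hy, hyz⟩
      · exact ⟨y, hy, .inl hyz⟩
      · exact ⟨y, ⟨Ioo_subset_Ico_self hy.1, hy.2⟩, .inr hyz⟩
    -- `Ω` contains points on both sides of the interface
    have hside : ∀ σ : ℝ, σ ≠ 0 → ∃ z ∈ Ω, X z * σ < 0 := by
      intro σ hσ
      have hc : ContinuousAt (fun r : ℝ => a0 + (1 / 2 : ℝ) • c0 + (-r * σ) • n) 0 := by fun_prop
      have hev : ∀ᶠ r : ℝ in nhdsWithin 0 (Ioi 0),
          a0 + (1 / 2 : ℝ) • c0 + (-r * σ) • n ∈ Ω :=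
        (hc.eventually_mem (hopen.mem_nhds
          (by simpa using hPt (1 / 2) (by norm_num)))).filter_mono nhdsWithin_le_nhds
      obtain ⟨r, hr, hr0 : 0 < r⟩ := (hev.and self_mem_nhdsWithin).exists
      refine ⟨_, hr, ?_⟩
      rw [hXn]
      nlinarith [mul_pos hr0 (mul_self_pos.2 hσ)]
    have hsgn : ∀ s ∈ Icc (0 : ℝ) 1, ∀ s' ∈ Icc (0 : ℝ) 1, α0 s * α1 s' < 0 := by
      rcases isPreconnected_Icc.pos_or_neg_of_ne_zero hcα0.continuous.continuousOn hα0ne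
        with p0 | p0 <;>
      rcases isPreconnected_Icc.pos_or_neg_of_ne_zero hcα1.continuous.continuousOn hα1ne
        with p1 | p1
      · obtain ⟨z, hz, hXz⟩ := hside 1 one_ne_zero
        obtain ⟨y, hy, rfl | rfl⟩ := hΩS z hz
        · rw [hXf hA0] at hXz
          nlinarith [mul_nonneg hy.1.1 (p0 y.2 (Ioo_subset_Icc_self hy.2)).le]
        · rw [hXf hA1] at hXz
          nlinarith [mul_nonneg hy.1.1 (p1 y.2 (Ioo_subset_Icc_self hy.2)).le]
      · exact fun s hs s' hs' => mul_neg_of_pos_of_neg (p0 s hs) (p1 s' hs')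
      · exact fun s hs s' hs' => mul_neg_of_neg_of_pos (p0 s hs) (p1 s' hs')
      · obtain ⟨z, hz, hXz⟩ := hside (-1) (by norm_num)
        obtain ⟨y, hy, rfl | rfl⟩ := hΩS z hz
        · rw [hXf hA0] at hXz
          nlinarith [mul_nonpos_of_nonneg_of_nonpos hy.1.1 (p0 y.2 (Ioo_subset_Icc_self hy.2)).le]
        · rw [hXf hA1] at hXz
          nlinarith [mul_nonpos_of_nonneg_of_nonpos hy.1.1 (p1 y.2 (Ioo_subset_Icc_self hy.2)).le]
    obtain ⟨φ, h0, h1⟩ := exists_glued_function (g₀ := g0) (g₁ := g1)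
      (hinj0.mono hSsub) (hinj1.mono hSsub) (by
        intro x hx y hy hxy
        have hX' := congrArg X hxy
        rw [hXf hA0, hXf hA1] at hX'
        have hxy2 := hsgn x.2 (hSsub hx).2 y.2 (hSsub hy).2
        have hne0 := hα0ne x.2 (hSsub hx).2
        have hne1 := hα1ne y.2 (hSsub hy).2
        have hx0 : x.1 = 0 := by
          by_contra h
          have hx1 : 0 < x.1 := lt_of_le_of_ne hx.1.1 (Ne.symm h)
          have hα1sq := mul_nonneg hy.1.1 (mul_self_nonneg (α1 y.2))
          have := mul_neg_of_pos_of_neg hx1 hxy2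
          have hmul : x.1 * (α0 x.2 * α1 y.2) = y.1 * (α1 y.2 * α1 y.2) := by
            linear_combination α1 y.2 * hX'
          linarith
        have hy0 : y.1 = 0 := by
          rw [hx0, zero_mul] at hX'
          exact (mul_eq_zero.1 hX'.symm).resolve_right hne1
        obtain ⟨x1, x2⟩ := x
        obtain ⟨y1, y2⟩ := y
        obtain rfl : x1 = 0 := hx0
        obtain rfl : y1 = 0 := hy0
        rw [← hiface y2 (hSsub hy).2] at hxy
        have := hinj0 (hSsub hx) (hSsub hy) hxy
        rw [this]
        exact (hglue y2 (hSsub hy).2).1)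
    refine ⟨φ, fun z hz => ContDiffAt.contDiffWithinAt ?_, h0, h1⟩
    have hint : ∀ {f : ℝ × ℝ → ℝ × ℝ} {b d : ℝ × ℝ} {g : ℝ × ℝ → ℝ},
        IsBilinearPatch f a0 b c0 d → InjOn f (Icc 0 1 ×ˢ Icc 0 1) → ContDiffOn ℝ 2 g U →
        (∀ y ∈ (Ico 0 1 ×ˢ Ioo 0 1 : Set (ℝ × ℝ)), φ (f y) = g y) →
        ∀ y ∈ (Ioo 0 1 ×ˢ Ioo 0 1 : Set (ℝ × ℝ)), ContDiffAt ℝ 2 φ (f y) := by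
      intro f b d g hf hinj hg hφ y hy
      have hny : (Ioo 0 1 ×ˢ Ioo 0 1 : Set (ℝ × ℝ)) ∈ nhds y :=
        (isOpen_Ioo.prod isOpen_Ioo).mem_nhds hy
      refine (hf.hasLocalInverse (hf.planeDet_ne_zero (hinj.mono hQsub) hny)).contDiffAt_of_comp_eq
        (hgc hg y (hQsub hy)) ?_
      filter_upwards [hny] with w hw using hφ w ⟨Ioo_subset_Ico_self hw.1, hw.2⟩
    rw [hΩ, hΩ0, hΩ1, hΓ] at hz
    rcases hz with (⟨y, hy, rfl⟩ | ⟨⟨t, s⟩, ⟨ht, hs⟩, rfl⟩) | ⟨y, hy, rfl⟩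
    · exact hint hB0 hinj0 hg0 h0 y hy
    · obtain rfl : t = 0 := ht
      have hs' : s ∈ Icc (0 : ℝ) 1 := Ioo_subset_Icc_self hs
      have hnear : ∀ᶠ y : ℝ × ℝ in nhds (0, s),
          0 ≤ y.1 → y ∈ (Ico 0 1 ×ˢ Ioo 0 1 : Set (ℝ × ℝ)) := by
        filter_upwards [(isOpen_Iio.prod isOpen_Ioo).mem_nhds
          (show ((0 : ℝ), s) ∈ Iio 1 ×ˢ Ioo 0 1 from ⟨by simp, hs⟩)] with y hy hy0
        exact ⟨⟨hy0, hy.1⟩, hy.2⟩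
      rw [hA0.apply_zero]
      refine contDiffAt_of_gluingAt hX hXn hspan hA0 hA1 (hB0.hasLocalInverse ?_)
        (hB1.hasLocalInverse ?_) (hgc0 hg0 s hs') (hgc0 hg1 s hs') hcα0.continuous.continuousAt
        hcα1.continuous.continuousAt (hsgn s hs' s hs') (hnear.mono fun y hy h => h0 y (hy h))
        (hnear.mono fun y hy h => h1 y (hy h)) ?_
      · simpa [planeDet] using right_ne_zero_of_mul (hα0ne s hs')
      · simpa [planeDet] using right_ne_zero_of_mul (hα1ne s hs')
      · filter_upwards [isOpen_Ioo.mem_nhds hs] with r hr using hglue r (Ioo_subset_Icc_self hr)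
    · exact hint hB1 hinj1 hg1 h1 y hy
end

section
/- For an integer k ≥ 2, define the finite set S̃_k = {4, 4k+1} ∪ ⋃_{i=0}^{⌊(k−6)/4⌋} ({9+8i, 12+8i} ∪ {4k+5−(9+8i), 4k+5−(12+8i)}) (where the union over i is empty if k < 6), and define S_k = S̃_k ∪ E_k, where E_k = {2k+1, 2k+4} if k ≡ 0 (mod 4), E_k = {2k−1, 2k+2, 2k+6} if k ≡ 1 (mod 4), E_k = ∅ if k ≡ 2 (mod 4), and E_k = {2k+2} if k ≡ 3 (mod 4). Then S_k ⊆ {0, 1, …, 4k+5} and the cardinality of S_k equals k; consequently, removing the points with indices in S_k from the 4(k+1)+2 superconvergent points leaves exactly 3k+6 clustered superconvergent points. -/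
/-- The index pairs `{9 + 8i, 12 + 8i}` and their mirror images under `x ↦ 4k + 5 - x`, for
`i < m`, together consist of `4m` distinct indices as soon as `4m + 2 ≤ k`. -/
lemma card_biUnion_mirrored_pairs (k m : ℕ) (hm : 4 * m + 2 ≤ k) :
    ((Finset.range m).biUnion
      (fun i => ({9 + 8 * i, 12 + 8 * i} : Finset ℕ) ∪
        {4 * k + 5 - (9 + 8 * i), 4 * k + 5 - (12 + 8 * i)})).card = 4 * m := by
  rw [Finset.card_biUnion]
  · have card_four : ∀ i ∈ Finset.range m, (({9 + 8 * i, 12 + 8 * i} : Finset ℕ) ∪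
        {4 * k + 5 - (9 + 8 * i), 4 * k + 5 - (12 + 8 * i)}).card = 4 := by
      intro i hi
      rw [Finset.mem_range] at hi
      rw [Finset.card_union_of_disjoint, Finset.card_pair (by omega),
        Finset.card_pair (by omega)]
      simp only [Finset.disjoint_left, Finset.mem_insert, Finset.mem_singleton]
      omega
    rw [Finset.sum_congr rfl card_four]
    simp [mul_comm]
  · intro i hi j hj hij
    rw [Finset.mem_coe, Finset.mem_range] at hi hj
    simp only [Function.onFun, Finset.disjoint_left, Finset.mem_union, Finset.mem_insert,
      Finset.mem_singleton]
    omega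

/-- For `k ≥ 2`, the omitted-index set
`S_k = S̃_k ∪ E_k` (with `S̃_k = {4, 4k+1} ∪ ⋃_{i=0}^{⌊(k−6)/4⌋} ({9+8i, 12+8i} ∪
{4k+5−(9+8i), 4k+5−(12+8i)})`, the union being empty if `k < 6`, and `E_k` depending on
`k mod 4` as specified) satisfies `S_k ⊆ {0,…,4k+5}` and `|S_k| = k`; consequently removing
these `k` points from the `4(k+1)+2` superconvergent points leaves `3k+6` clustered
superconvergent points. -/
theorem clustered_superconvergent_card (k : ℕ) (hk : 2 ≤ k)
    (Stilde E S : Finset ℕ)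
    (hStilde : Stilde = {4, 4 * k + 1} ∪
      (Finset.range (if k < 6 then 0 else (k - 6) / 4 + 1)).biUnion
        (fun i => ({9 + 8 * i, 12 + 8 * i} : Finset ℕ) ∪
          {4 * k + 5 - (9 + 8 * i), 4 * k + 5 - (12 + 8 * i)}))
    (hE : E = if k % 4 = 0 then ({2 * k + 1, 2 * k + 4} : Finset ℕ)
      else if k % 4 = 1 then ({2 * k - 1, 2 * k + 2, 2 * k + 6} : Finset ℕ)
      else if k % 4 = 2 then (∅ : Finset ℕ)
      else ({2 * k + 2} : Finset ℕ))
    (hS : S = Stilde ∪ E) :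
    S ⊆ Finset.range (4 * k + 5 + 1) ∧ S.card = k ∧
      (4 * (k + 1) + 2) - k = 3 * k + 6 := by
  obtain ⟨m, hm⟩ : ∃ m, m = if k < 6 then 0 else (k - 6) / 4 + 1 := ⟨_, rfl⟩
  rw [← hm] at hStilde
  replace hm : m = (k - 2) / 4 := by split_ifs at hm <;> omega
  have hStilde_card : Stilde.card = 4 * m + 2 := by
    rw [hStilde, Finset.card_union_of_disjoint, card_biUnion_mirrored_pairs k m (by omega),
      Finset.card_pair (by omega), add_comm]
    simp only [Finset.disjoint_left, Finset.mem_biUnion, Finset.mem_range, Finset.mem_union,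
      Finset.mem_insert, Finset.mem_singleton]
    rintro a ha ⟨i, hi, hai⟩
    omega
  have hE_card : E.card = k - (4 * m + 2) := by
    rw [hE]
    split_ifs
    · rw [Finset.card_pair (by omega)]
      omega
    · rw [Finset.card_eq_three.mpr ⟨_, _, _, by omega, by omega, by omega, rfl⟩]
      omega
    · rw [Finset.card_empty]
      omega
    · rw [Finset.card_singleton]
      omega
  have hE_mem : ∀ a ∈ E,
      (k % 4 = 0 → a = 2 * k + 1 ∨ a = 2 * k + 4) ∧
      (k % 4 = 1 → a = 2 * k - 1 ∨ a = 2 * k + 2 ∨ a = 2 * k + 6) ∧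
      k % 4 ≠ 2 ∧ (k % 4 = 3 → a = 2 * k + 2) := by
    intro a ha
    rw [hE] at ha
    split_ifs at ha <;>
      simp only [Finset.mem_insert, Finset.mem_singleton, Finset.notMem_empty] at ha <;> omega
  have hdisj : Disjoint Stilde E := by
    rw [Finset.disjoint_left]
    intro a ha haE
    have := hE_mem a haE
    simp only [hStilde, Finset.mem_biUnion, Finset.mem_range, Finset.mem_union,
      Finset.mem_insert, Finset.mem_singleton] at ha
    rcases ha with ha | ⟨i, hi, hai⟩ <;> omega
  refine ⟨fun a ha => ?_, ?_, by omega⟩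
  · rw [hS, Finset.mem_union] at ha
    rw [Finset.mem_range]
    rcases ha with ha | ha
    · simp only [hStilde, Finset.mem_biUnion, Finset.mem_range, Finset.mem_union,
        Finset.mem_insert, Finset.mem_singleton] at ha
      rcases ha with ha | ⟨i, hi, hai⟩ <;> omega
    · have := hE_mem a ha
      omega
  · rw [hS, Finset.card_union_of_disjoint hdisj, hStilde_card, hE_card]
    omega
end
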